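/- Let 𝒪 ⊂ ℝ^d be a bounded domain, p ∈ [1,2], and suppose Assumptions A1 and B–E hold. Let u be a viscosity subsolution and v a viscosity supersolution of (E) with u(x) ≤ v(x) for all x ∉ 𝒪. If either u or v belongs to C^{0,r}(𝒪) for some r ∈ (0,1) and 1 − r/p < s (with s from Assumption A1), then u(x) ≤ v(x) for all x ∈ 𝒪. -/

import Mathlib

open MeasureTheory Set Metric Filter
open scoped ENNReal NNReal

noncomputable section

abbrev Euc (d : ℕ) := EuclideanSpace ℝ (Fin d)

variable {d : ℕ} {A B : Type*}

/-- `μ ∈ 𝕃_p(ℝ^d)`: a positive Borel measure on `ℝ^d ∖ {0}` (modeled as a measure on `ℝ^d`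
vanishing on `{0}`) with `N_p(μ) = ∫ min(1,|z|^p) dμ < ∞`. -/
def IsLevyLp (p : ℝ) (μ : Measure (Euc d)) : Prop :=
  μ {0} = 0 ∧ ∫⁻ z, ENNReal.ofReal (min 1 (‖z‖ ^ p)) ∂μ < ⊤

/-- `μ ∈ 𝕃_p(Ω)`: member of `𝕃_p(ℝ^d)` giving no mass to the complement of `Ω`. -/
def IsLevyLpOn (p : ℝ) (Ω : Set (Euc d)) (μ : Measure (Euc d)) : Prop :=
  IsLevyLp p μ ∧ μ Ωᶜ = 0

/-- `μ ∈ M_p(ℝ^d)`: Lévy measure with finite `p`-moment. -/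
def IsMp (p : ℝ) (μ : Measure (Euc d)) : Prop :=
  IsLevyLp p μ ∧ ∫⁻ z, ENNReal.ofReal (‖z‖ ^ p) ∂μ < ⊤

/-- Admissible transport plans between `μ₁` and `μ₂`: positive Borel measures on `ℝ^d × ℝ^d`
with no mass at `(0,0)` whose marginals, restricted to `ℝ^d ∖ {0}`, are `μ₁` and `μ₂`. -/
def AdmPlan (μ₁ μ₂ : Measure (Euc d)) : Set (Measure (Euc d × Euc d)) :=
  {γ | γ {((0 : Euc d), (0 : Euc d))} = 0 ∧
       (γ.map Prod.fst).restrict {(0 : Euc d)}ᶜ = μ₁ ∧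
       (γ.map Prod.snd).restrict {(0 : Euc d)}ᶜ = μ₂}

/-- The transport cost functional `J_p(γ) = ∫ |x-y|^p dγ`. -/
def Jp (p : ℝ) (γ : Measure (Euc d × Euc d)) : ℝ≥0∞ :=
  ∫⁻ q, ENNReal.ofReal (‖q.1 - q.2‖ ^ p) ∂γ

/-- `d_{𝕃_p}(μ,ν)^p` as an extended nonnegative real. -/
def dLpPow (p : ℝ) (μ ν : Measure (Euc d)) : ℝ≥0∞ :=
  ⨅ γ ∈ AdmPlan μ ν, Jp p γ

/-- The transport distance `d_{𝕃_p}`. -/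
def dLp (p : ℝ) (μ ν : Measure (Euc d)) : ℝ :=
  (dLpPow p μ ν).toReal ^ (1 / p)

/-- Total variation distance `|μ - ν|(X)` between two positive measures. -/
def dTV {X : Type*} [MeasurableSpace X] (μ ν : Measure X) : ℝ≥0∞ :=
  (⨆ (s : Set X) (_ : MeasurableSet s), μ s - ν s) +
  (⨆ (s : Set X) (_ : MeasurableSet s), ν s - μ s)

/-- A modulus of continuity. -/
def IsModulus (θ : ℝ → ℝ) : Prop :=
  (∀ r, 0 ≤ θ r) ∧ Monotone θ ∧ Tendsto θ (nhdsWithin 0 (Ioi 0)) (nhds 0)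

/-- Bounded uniformly continuous functions on `ℝ^d`. -/
def IsBUC (u : Euc d → ℝ) : Prop :=
  (∃ M, ∀ x, |u x| ≤ M) ∧ UniformContinuous u

/-- The Lévy operator `L_μ(φ,x) = ∫ [φ(x+z) - φ(x) - χ_{B₁}(z) Dφ(x)·z] dμ(z)`. -/
def Lop (μ : Measure (Euc d)) (φ : Euc d → ℝ) (x : Euc d) : ℝ :=
  ∫ z, (φ (x + z) - φ x -
    (ball (0 : Euc d) 1).indicator (fun w => fderiv ℝ φ x w) z) ∂μ

/-- The operator `I(φ,x) = sup_α inf_β { -L^{αβ}(φ,x) + c_{αβ}(x) φ(x) + f_{αβ}(x) }`. -/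
def Iop (μf : Euc d → A → B → Measure (Euc d)) (c f : A → B → Euc d → ℝ)
    (φ : Euc d → ℝ) (x : Euc d) : ℝ :=
  ⨆ α : A, ⨅ β : B, (-(Lop (μf x α β) φ x) + c α β x * φ x + f α β x)

/-- Viscosity subsolution of `J(u,x) = 0` in `O`. -/
def IsSubsolution (O : Set (Euc d)) (J : (Euc d → ℝ) → Euc d → ℝ) (u : Euc d → ℝ) : Prop :=
  ∀ φ : Euc d → ℝ, ContDiff ℝ 2 φ → (∃ M, ∀ x, |φ x| ≤ M) →
    ∀ x ∈ O, (∀ y, u y - φ y ≤ u x - φ x) → φ x = u x → J φ x ≤ 0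

/-- Viscosity supersolution of `J(u,x) = 0` in `O`. -/
def IsSupersolution (O : Set (Euc d)) (J : (Euc d → ℝ) → Euc d → ℝ) (u : Euc d → ℝ) : Prop :=
  ∀ φ : Euc d → ℝ, ContDiff ℝ 2 φ → (∃ M, ∀ x, |φ x| ≤ M) →
    ∀ x ∈ O, (∀ y, u x - φ x ≤ u y - φ y) → φ x = u x → 0 ≤ J φ x

/-- Assumption A, stated for a family `νhat` (the parts of the Lévy measures near the origin):
Lipschitz continuity in the transport metric `d_{𝕃_p}`. -/
def AssumptionA (O : Set (Euc d)) (p : ℝ) (νhat : Euc d → A → B → Measure (Euc d)) : Prop :=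
  ∃ C : ℝ, 0 ≤ C ∧ ∀ x ∈ O, ∀ y ∈ O, ∀ (α : A) (β : B),
    dLp p (νhat x α β) (νhat y α β) ≤ C * ‖x - y‖

/-- Assumption A1: `s`-Hölder continuity in the transport metric `d_{𝕃_p}`. -/
def AssumptionA1 (O : Set (Euc d)) (p s : ℝ) (νhat : Euc d → A → B → Measure (Euc d)) : Prop :=
  ∃ C : ℝ, 0 < C ∧ ∀ x ∈ O, ∀ y ∈ O, ∀ (α : A) (β : B),
    dLp p (νhat x α β) (νhat y α β) ≤ C * ‖x - y‖ ^ s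

/-- Assumption B: continuity in total variation of the tails. -/
def AssumptionB (O : Set (Euc d)) (νcheck : Euc d → A → B → Measure (Euc d)) : Prop :=
  ∃ θ : ℝ → ℝ, IsModulus θ ∧ ∀ x ∈ O, ∀ y ∈ O, ∀ (α : A) (β : B),
    dTV (νcheck x α β) (νcheck y α β) ≤ ENNReal.ofReal (θ ‖x - y‖)

/-- Assumption C: equicontinuity and uniform boundedness of `f_{αβ}`. -/
def AssumptionC (O : Set (Euc d)) (f : A → B → Euc d → ℝ) : Prop :=
  ∃ θ : ℝ → ℝ, IsModulus θ ∧ ∃ C : ℝ, 0 ≤ C ∧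
    (∀ x ∈ O, ∀ y ∈ O, ∀ (α : A) (β : B), |f α β x - f α β y| ≤ θ ‖x - y‖) ∧
    (∀ x ∈ O, ∀ (α : A) (β : B), |f α β x| ≤ C)

/-- Assumption D: `0 < λ ≤ c_{αβ} ≤ λ₁` and equicontinuity of `c_{αβ}`. -/
def AssumptionD (O : Set (Euc d)) (c : A → B → Euc d → ℝ) : Prop :=
  ∃ lam lam1 : ℝ, 0 < lam ∧ lam ≤ lam1 ∧
    (∀ x ∈ O, ∀ (α : A) (β : B), lam ≤ c α β x ∧ c α β x ≤ lam1) ∧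
    ∃ θ : ℝ → ℝ, IsModulus θ ∧
      ∀ x ∈ O, ∀ y ∈ O, ∀ (α : A) (β : B), |c α β x - c α β y| ≤ θ ‖x - y‖

/-- Assumption E: uniform integrability of the Lévy measures. -/
def AssumptionE (O : Set (Euc d)) (p : ℝ) (μf : Euc d → A → B → Measure (Euc d)) : Prop :=
  (∃ θ : ℝ → ℝ, IsModulus θ ∧ ∀ r : ℝ, 0 < r → ∀ x ∈ O, ∀ (α : A) (β : B),
      ∫⁻ z in ball (0 : Euc d) r, ENNReal.ofReal (‖z‖ ^ p) ∂(μf x α β) ≤ ENNReal.ofReal (θ r)) ∧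
  (∃ Λ : ℝ, 0 ≤ Λ ∧ ∀ x ∈ O, ∀ (α : A) (β : B),
      ∫⁻ z, ENNReal.ofReal (min 1 (‖z‖ ^ p)) ∂(μf x α β) ≤ ENNReal.ofReal Λ)

/-- The smooth approximation `ψ_κ(x) = (κ + |x|²)^{p/2} - κ^{p/2}` of `|x|^p`. -/
def psiK (p κ : ℝ) (x : Euc d) : ℝ := (κ + ‖x‖ ^ 2) ^ (p / 2) - κ ^ (p / 2)

/-- `u` is pointwise-`C^{1,1}` at `x₀`. -/
def PointwiseC11 (u : Euc d → ℝ) (x₀ : Euc d) : Prop :=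
  DifferentiableAt ℝ u x₀ ∧ ∃ C : ℝ, 0 < C ∧ ∀ᶠ x in nhds x₀,
    |u x - u x₀ - fderiv ℝ u x₀ (x - x₀)| ≤ C * ‖x - x₀‖ ^ 2

/-- Sup-convolution `u^δ`. -/
def supConv (δ : ℝ) (u : Euc d → ℝ) (x : Euc d) : ℝ :=
  ⨆ y : Euc d, (u y - ‖x - y‖ ^ 2 / δ)

/-- Inf-convolution `v_δ`. -/
def infConv (δ : ℝ) (v : Euc d → ℝ) (x : Euc d) : ℝ :=
  ⨅ y : Euc d, (v y + ‖x - y‖ ^ 2 / δ)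

/-- `(φ,ψ) ∈ Adm^p`, the admissible pairs for the dual problem. -/
def AdmPair (p : ℝ) (μ₁ μ₂ : Measure (Euc d)) (φ ψ : Euc d → ℝ) : Prop :=
  Integrable φ μ₁ ∧ Integrable ψ μ₂ ∧
  UpperSemicontinuous φ ∧ UpperSemicontinuous ψ ∧
  φ 0 = 0 ∧ ψ 0 = 0 ∧ ∀ x y : Euc d, φ x + ψ y ≤ ‖x - y‖ ^ p

lemma sq_rpow_half {t : ℝ} (ht : 0 ≤ t) (p : ℝ) : (t ^ 2) ^ (p / 2) = t ^ p := by
  rw [← Real.rpow_natCast, ← Real.rpow_mul ht]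
  congr 1
  push_cast
  ring

lemma contDiff_psiK {p κ : ℝ} (hκ : 0 < κ) : ContDiff ℝ 2 (psiK (d := d) p κ) := by
  unfold psiK
  refine ContDiff.sub (ContDiff.rpow_const_of_ne ?_ fun x => by positivity) contDiff_const
  exact contDiff_const.add (contDiff_norm_sq ℝ)

/-- The gradient of `psiK p κ` at `a`, as a continuous linear form. -/
def psiKGrad (p κ : ℝ) (a : Euc d) : Euc d →L[ℝ] ℝ :=
  (p * (κ + ‖a‖ ^ 2) ^ (p / 2 - 1)) • innerSL ℝ a

lemma hasFDerivAt_psiK {p κ : ℝ} (hκ : 0 < κ) (a : Euc d) :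
    HasFDerivAt (psiK p κ) (psiKGrad p κ a) a := by
  have h1 : HasFDerivAt (fun x : Euc d => κ + ‖x‖ ^ 2) ((2 : ℝ) • innerSL ℝ a) a := by
    have := (hasStrictFDerivAt_norm_sq a).hasFDerivAt.const_add κ
    simpa [two_smul] using this
  have h2 := (h1.rpow_const (p := p / 2) (Or.inl (by positivity))).sub_const (κ ^ (p / 2))
  refine h2.congr_fderiv ?_
  rw [psiKGrad, smul_smul]
  congr 1
  ring

lemma psiK_add_sub_le {p κ : ℝ} (hp1 : 1 ≤ p) (hp2 : p ≤ 2) (hκ : 0 < κ) (a h : Euc d) :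
    psiK p κ (a + h) - psiK p κ a - psiKGrad p κ a h ≤ 6 * ‖h‖ ^ p := by
  have hin : ‖a + h‖ ^ 2 = ‖a‖ ^ 2 + 2 * inner ℝ a h + ‖h‖ ^ 2 := norm_add_sq_real a h
  have hcs : |inner ℝ a h| ≤ ‖a‖ * ‖h‖ := abs_real_inner_le_norm a h
  have ha : ‖a‖ ^ 2 ≤ κ + ‖a‖ ^ 2 := by linarith
  simp only [psiK, psiKGrad, smul_apply, innerSL_apply_apply, smul_eq_mul]
  have hR : 0 < κ + ‖a‖ ^ 2 := by positivity
  have hpos : 0 ≤ κ + ‖a + h‖ ^ 2 := by positivity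
  rw [hin] at hpos ⊢
  rw [← sq_rpow_half (norm_nonneg h) p]
  generalize hRdef : κ + ‖a‖ ^ 2 = R at *
  have hH : 0 ≤ ‖h‖ ^ 2 := by positivity
  rcases hH.eq_or_lt with h0 | hH'
  · have : h = 0 := by
      rw [← norm_eq_zero]; exact pow_eq_zero_iff (two_ne_zero) |>.1 h0.symm
    subst this
    have : (0:ℝ) ≤ (‖(0 : Euc d)‖ ^ 2) ^ (p / 2) := by positivity
    simp only [inner_zero_right, mul_zero, norm_zero, ne_eq, OfNat.ofNat_ne_zero,
      not_false_eq_true, zero_pow, add_zero] at this ⊢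
    rw [hRdef]
    linarith
  rcases le_or_gt (‖h‖ ^ 2) R with hle | hgt
  · have e : κ + (‖a‖ ^ 2 + 2 * inner ℝ a h + ‖h‖ ^ 2)
        = R * (1 + (2 * inner ℝ a h + ‖h‖ ^ 2) / R) := by
      field_simp
      linarith
    have ht : -1 ≤ (2 * inner ℝ a h + ‖h‖ ^ 2) / R := by
      rw [le_div_iff₀ hR]; linarith
    have hb := rpow_one_add_le_one_add_mul_self ht (p := p / 2) (by linarith) (by linarith)
    rw [e, Real.mul_rpow hR.le (by linarith)]
    have hb' := mul_le_mul_of_nonneg_left hb (Real.rpow_nonneg hR.le (p / 2))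
    have e2 : R ^ (p / 2) = R ^ (p / 2 - 1) * R := by
      rw [Real.rpow_sub_one hR.ne']; field_simp
    have hm : R ^ (p / 2 - 1) ≤ (‖h‖ ^ 2) ^ (p / 2 - 1) :=
      Real.rpow_le_rpow_of_nonpos hH' hle (by linarith)
    have e3 : (‖h‖ ^ 2) ^ (p / 2) = (‖h‖ ^ 2) ^ (p / 2 - 1) * ‖h‖ ^ 2 := by
      rw [Real.rpow_sub_one hH'.ne', div_mul_cancel₀ _ hH'.ne']
    have hm' := mul_le_mul_of_nonneg_right hm hH
    rw [← e3] at hm'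
    have e4 : R ^ (p / 2) * (1 + p / 2 * ((2 * inner ℝ a h + ‖h‖ ^ 2) / R))
       = R ^ (p / 2) + p * R ^ (p / 2 - 1) * inner ℝ a h
         + p / 2 * (R ^ (p / 2 - 1) * ‖h‖ ^ 2) := by
      rw [e2]; field_simp; ring
    rw [e4] at hb'
    have : 0 ≤ R ^ (p / 2 - 1) * ‖h‖ ^ 2 := by positivity
    nlinarith
  · have hah : ‖a‖ ≤ ‖h‖ := by
      refine le_of_sq_le_sq ?_ (norm_nonneg h)
      linarith
    have h1 : κ + (‖a‖ ^ 2 + 2 * inner ℝ a h + ‖h‖ ^ 2) ≤ 4 * ‖h‖ ^ 2 := by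
      have := (abs_le.1 hcs).2
      nlinarith [norm_nonneg a, norm_nonneg h]
    have h2 := Real.rpow_le_rpow hpos h1 (z := p / 2) (by linarith)
    rw [Real.mul_rpow (by norm_num) hH] at h2
    have h4 : (4 : ℝ) ^ (p / 2) ≤ 4 := by
      calc (4 : ℝ) ^ (p / 2) ≤ 4 ^ (1 : ℝ) :=
            Real.rpow_le_rpow_of_exponent_le (by norm_num) (by linarith)
        _ = 4 := by norm_num
    have hX : 0 ≤ (‖h‖ ^ 2) ^ (p / 2) := by positivity
    have h5 : R ^ (p / 2 - 1) * (‖a‖ * ‖h‖) ≤ (‖h‖ ^ 2) ^ (p / 2) := by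
      have ea : ‖a‖ ≤ R ^ (1 / 2 : ℝ) := by
        rw [← Real.sqrt_eq_rpow]; exact Real.le_sqrt_of_sq_le ha
      have eh : ‖h‖ = (‖h‖ ^ 2) ^ (1 / 2 : ℝ) := by
        rw [← Real.sqrt_eq_rpow, Real.sqrt_sq (norm_nonneg h)]
      calc R ^ (p / 2 - 1) * (‖a‖ * ‖h‖)
          ≤ R ^ (p / 2 - 1) * (R ^ (1 / 2 : ℝ) * ‖h‖) := by gcongr
        _ = R ^ (p / 2 - 1 / 2) * ‖h‖ := by
            rw [← mul_assoc, ← Real.rpow_add hR]; congr 2; ring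
        _ ≤ (‖h‖ ^ 2) ^ (p / 2 - 1 / 2) * ‖h‖ := by
            gcongr
            linarith
        _ = (‖h‖ ^ 2) ^ (p / 2 - 1 / 2) * (‖h‖ ^ 2) ^ (1 / 2 : ℝ) := by rw [← eh]
        _ = (‖h‖ ^ 2) ^ (p / 2) := by
            rw [← Real.rpow_add hH']; congr 1; ring
    have h6 : -(R ^ (p / 2 - 1) * inner ℝ a h) ≤ R ^ (p / 2 - 1) * (‖a‖ * ‖h‖) := by
      have := (abs_le.1 hcs).1
      have := mul_le_mul_of_nonneg_left this (Real.rpow_nonneg hR.le (p / 2 - 1))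
      linarith
    have h7 : 0 ≤ R ^ (p / 2) := by positivity
    nlinarith

/-- Choice of the penalization parameters: whenever the doubling penalization is controlled by
the Hölder modulus, the transport cost is negligible with respect to `ε`. -/
lemma exists_penalization_params {p s r : ℝ} (hp1 : 1 ≤ p) (hs0 : 0 < s)
    (hs1 : s < 1) (hr1 : r < 1) (hrs : 1 - r / p < s) {Ch M η : ℝ} (hCh : 0 < Ch)
    (hη : 0 < η) :
    ∃ ε κ : ℝ, 0 < ε ∧ 0 < κ ∧
      (∀ t : ℝ, 0 ≤ t → ((κ + t ^ 2) ^ (p / 2) - κ ^ (p / 2)) / ε ≤ M → t < η) ∧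
      ∀ t : ℝ, 0 ≤ t → ((κ + t ^ 2) ^ (p / 2) - κ ^ (p / 2)) / ε ≤ Ch * t ^ r →
        (t ^ s) ^ p ≤ η * ε := by
  have hp0 : 0 < p := by linarith
  have hpr : 0 < p - r := by linarith
  have hsp : p - r < s * p := by
    have : (1 - r / p) * p < s * p := by gcongr
    have e : (1 - r / p) * p = p - r := by field_simp
    linarith
  have hexp : 0 < s * p / (p - r) - 1 := by
    rw [sub_pos, lt_div_iff₀ hpr]; linarith
  have T1 : Tendsto (fun ε : ℝ => (M + 1) * ε) (nhdsWithin 0 (Ioi 0)) (nhds 0) := by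
    have : Tendsto (fun ε : ℝ => (M + 1) * ε) (nhds 0) (nhds ((M + 1) * 0)) :=
      tendsto_id.const_mul _
    rw [mul_zero] at this
    exact this.mono_left nhdsWithin_le_nhds
  have T2 : Tendsto (fun ε : ℝ => (2 * Ch) ^ (s * p / (p - r)) * ε ^ (s * p / (p - r) - 1))
      (nhdsWithin 0 (Ioi 0)) (nhds 0) := by
    have h := (Real.continuousAt_rpow_const 0 (s * p / (p - r) - 1) (Or.inr hexp.le)).tendsto
    rw [Real.zero_rpow hexp.ne'] at h
    have := h.const_mul ((2 * Ch) ^ (s * p / (p - r)))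
    rw [mul_zero] at this
    exact this.mono_left nhdsWithin_le_nhds
  obtain ⟨ε, ⟨h1, h2⟩, hε⟩ := (((T1.eventually_lt_const (Real.rpow_pos_of_pos hη p)).and
    (T2.eventually_lt_const hη)).and self_mem_nhdsWithin).exists
  replace hε : 0 < ε := hε
  have hηε : 0 < η * ε := by positivity
  obtain ⟨K, hK0, hK1, hK2⟩ : ∃ K : ℝ, 0 < K ∧ K ≤ ε ∧ (2 * K) ^ s ≤ η * ε := by
    have T3 : Tendsto (fun K : ℝ => (2 * K) ^ s) (nhdsWithin 0 (Ioi 0)) (nhds 0) := by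
      have h : ContinuousAt (fun K : ℝ => (2 * K) ^ s) 0 :=
        ContinuousAt.rpow_const (by fun_prop) (Or.inr hs0.le)
      have := h.tendsto
      simp only [mul_zero, Real.zero_rpow hs0.ne'] at this
      exact this.mono_left nhdsWithin_le_nhds
    have T4 : Tendsto (fun K : ℝ => K) (nhdsWithin 0 (Ioi 0)) (nhds 0) :=
      tendsto_id.mono_left nhdsWithin_le_nhds
    obtain ⟨K, ⟨a, b⟩, c⟩ := (((T3.eventually_lt_const hηε).and
      (T4.eventually_lt_const hε)).and self_mem_nhdsWithin).exists
    exact ⟨K, c, b.le, a.le⟩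
  have hκ : (K ^ (2 / p)) ^ (p / 2) = K := by
    rw [← Real.rpow_mul hK0.le]
    have : 2 / p * (p / 2) = 1 := by field_simp
    rw [this, Real.rpow_one]
  have hlow : ∀ t : ℝ, 0 ≤ t → t ^ p ≤ (K ^ (2 / p) + t ^ 2) ^ (p / 2) := by
    intro t ht
    rw [← sq_rpow_half ht p]
    refine Real.rpow_le_rpow (by positivity) ?_ (by linarith)
    have : 0 < K ^ (2 / p) := Real.rpow_pos_of_pos hK0 _
    linarith
  refine ⟨ε, K ^ (2 / p), hε, Real.rpow_pos_of_pos hK0 _, ?_, ?_⟩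
  · intro t ht h
    rw [hκ, div_le_iff₀ hε] at h
    have := hlow t ht
    by_contra! hcon
    have := Real.rpow_le_rpow hη.le hcon hp0.le
    nlinarith
  · intro t ht h
    rw [hκ, div_le_iff₀ hε] at h
    have hl := hlow t ht
    have ets : (t ^ s) ^ p = (t ^ p) ^ s := by
      rw [← Real.rpow_mul ht, ← Real.rpow_mul ht, mul_comm]
    rcases le_total (t ^ p) (2 * K) with hc | hc
    · rw [ets]
      exact (Real.rpow_le_rpow (by positivity) hc hs0.le).trans hK2
    · have h3 : t ^ p ≤ 2 * Ch * ε * t ^ r := by nlinarith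
      have ht0 : 0 < t := by
        rcases ht.eq_or_lt with h0 | h0
        · rw [← h0, Real.zero_rpow hp0.ne'] at hc; linarith
        · exact h0
      have h4 : t ^ (p - r) ≤ 2 * Ch * ε := by
        rw [Real.rpow_sub ht0, div_le_iff₀ (Real.rpow_pos_of_pos ht0 r)]
        exact h3
      have h5 := Real.rpow_le_rpow (by positivity) h4 (z := s * p / (p - r)) (by linarith)
      rw [← Real.rpow_mul ht, mul_div_cancel₀ _ hpr.ne', Real.mul_rpow (by positivity) hε.le]
        at h5
      have e6 : ε ^ (s * p / (p - r)) = ε ^ (s * p / (p - r) - 1) * ε := by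
        rw [Real.rpow_sub_one hε.ne']; field_simp
      rw [← Real.rpow_mul ht]
      rw [e6, ← mul_assoc] at h5
      exact h5.trans (by gcongr)

lemma exists_smooth_touching {u φ₀ : Euc d → ℝ} (hu : IsBUC u) (hφ₀ : ContDiff ℝ 2 φ₀)
    (hle : ∀ y, u y ≤ φ₀ y) {x : Euc d} (heq : φ₀ x = u x) {δ η : ℝ} (hδ : 0 < δ) (hη : 0 < η) :
    ∃ φ : Euc d → ℝ, ContDiff ℝ 2 φ ∧ (∃ M, ∀ y, |φ y| ≤ M) ∧ (∀ y, u y ≤ φ y) ∧ φ x = u x ∧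
      fderiv ℝ φ x = fderiv ℝ φ₀ x ∧ (∀ y, ‖y - x‖ < δ / 2 → φ y ≤ φ₀ y) ∧
      (∀ y, φ y ≤ φ₀ y + η) ∧ ∀ y, δ ≤ ‖y - x‖ → φ y ≤ u y + η := by
  obtain ⟨⟨M, hM⟩, huc⟩ := hu
  obtain ⟨g, hg, hgu⟩ := huc.exists_contDiff_dist_le (half_pos hη)
  have hg1 : ∀ y, u y ≤ g y + η / 2 := fun y => by
    have := (abs_lt.1 (Real.dist_eq _ _ ▸ hgu y)).1; linarith
  have hg2 : ∀ y, g y + η / 2 ≤ u y + η := fun y => by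
    have := (abs_lt.1 (Real.dist_eq _ _ ▸ hgu y)).2; linarith
  let χ : ContDiffBump x := ⟨δ / 2, δ, half_pos hδ, half_lt_self hδ⟩
  have hg' : ContDiff ℝ 2 g := contDiff_infty.1 hg 2
  have hnear : ∀ y, ‖y - x‖ < δ / 2 → χ y * φ₀ y + (1 - χ y) * (g y + η / 2) = φ₀ y := by
    intro y hy
    have : χ y = 1 := χ.one_of_mem_closedBall
      (by rw [mem_closedBall, dist_eq_norm]; exact hy.le)
    rw [this]; ring
  have hxx : χ x * φ₀ x + (1 - χ x) * (g x + η / 2) = φ₀ x := hnear x (by simpa using hδ)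
  refine ⟨fun y => χ y * φ₀ y + (1 - χ y) * (g y + η / 2), ?_, ?_, ?_, ?_, ?_, ?_, ?_, ?_⟩
  · exact (χ.contDiff.mul hφ₀).add ((contDiff_const.sub χ.contDiff).mul (hg'.add contDiff_const))
  · obtain ⟨C, hC⟩ := (χ.continuous.mul hφ₀.continuous).bounded_above_of_compact_support
      (χ.hasCompactSupport.mul_right)
    refine ⟨C + (M + η), fun y => ?_⟩
    have h1 : |χ y * φ₀ y| ≤ C := hC y
    have h0 := χ.nonneg (x := y)
    have h0' := χ.le_one (x := y)
    have h2 : |g y + η / 2| ≤ M + η := by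
      have := abs_le.1 (hM y)
      rw [abs_le]
      constructor <;> linarith [hg1 y, hg2 y]
    have h3 : |(1 - χ y) * (g y + η / 2)| ≤ M + η := by
      rw [abs_mul, abs_of_nonneg (by linarith : 0 ≤ 1 - χ y)]
      nlinarith [abs_nonneg (g y + η / 2)]
    exact (abs_add_le _ _).trans (add_le_add h1 h3)
  · intro y
    have h0 := χ.nonneg (x := y)
    have h0' := χ.le_one (x := y)
    nlinarith [hle y, hg1 y]
  · exact hxx.trans heq
  · refine Filter.EventuallyEq.fderiv_eq ?_
    filter_upwards [ball_mem_nhds x (half_pos hδ)] with y hy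
    exact hnear y (by rwa [mem_ball, dist_eq_norm] at hy)
  · exact fun y hy => (hnear y hy).le
  · intro y
    have h0 := χ.nonneg (x := y)
    have h0' := χ.le_one (x := y)
    nlinarith [hle y, hg2 y]
  · intro y hy
    have : χ y = 0 := χ.zero_of_le_dist (by rw [dist_eq_norm]; exact hy)
    simp only [this]
    linarith [hg2 y]

lemma exists_levy_test_function {u φ₀ : Euc d → ℝ} (hu : IsBUC u) (hφ₀ : ContDiff ℝ 2 φ₀)
    (hle : ∀ y, u y ≤ φ₀ y) {x : Euc d} (heq : φ₀ x = u x) {p K δ η : ℝ} (hp : 1 ≤ p)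
    (hK : ∀ z, φ₀ (x + z) - φ₀ x - fderiv ℝ φ₀ x z ≤ K * ‖z‖ ^ p)
    (hδ : 0 < δ) (hδ1 : δ ≤ 1) (hη : 0 < η) :
    ∃ φ : Euc d → ℝ, ContDiff ℝ 2 φ ∧ (∃ M, ∀ y, |φ y| ≤ M) ∧ (∀ y, u y ≤ φ y) ∧ φ x = u x ∧
      fderiv ℝ φ x = fderiv ℝ φ₀ x ∧
      (∀ z, φ (x + z) - φ x - fderiv ℝ φ₀ x z ≤ K * ‖z‖ ^ p + η * min 1 (‖z‖ ^ p)) ∧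
      ∀ z, δ ≤ ‖z‖ → φ (x + z) ≤ u (x + z) + η * min 1 (‖z‖ ^ p) := by
  have hδp : 0 < (δ / 2) ^ p := Real.rpow_pos_of_pos (half_pos hδ) p
  obtain ⟨φ, h1, h2, h3, h4, h5, h6, h7, h8⟩ :=
    exists_smooth_touching hu hφ₀ hle heq hδ (mul_pos hη hδp)
  have key : ∀ z : Euc d, δ / 2 ≤ ‖z‖ → (δ / 2) ^ p ≤ min 1 (‖z‖ ^ p) := by
    intro z hz
    refine le_min (Real.rpow_le_one (by linarith) (by linarith) (by linarith)) ?_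
    exact Real.rpow_le_rpow (by linarith) hz (by linarith)
  refine ⟨φ, h1, h2, h3, h4, h5, fun z => ?_, fun z hz => ?_⟩
  · have hKz := hK z
    rw [heq] at hKz
    rw [h4]
    rcases lt_or_ge ‖z‖ (δ / 2) with hz | hz
    · have := h6 (x + z) (by simpa using hz)
      have : 0 ≤ η * min 1 (‖z‖ ^ p) := by positivity
      linarith
    · have := h7 (x + z)
      have := mul_le_mul_of_nonneg_left (key z hz) hη.le
      linarith
  · have := h8 (x + z) (by simpa using hz)
    have := mul_le_mul_of_nonneg_left (key z (by linarith)) hη.le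
    linarith

/-- The integrand of the operator `Lop`. -/
def levyIncrement (φ : Euc d → ℝ) (x z : Euc d) : ℝ :=
  φ (x + z) - φ x - (ball (0 : Euc d) 1).indicator (fun w => fderiv ℝ φ x w) z

lemma exists_levyIncrement_bound {φ : Euc d → ℝ} (hφ : ContDiff ℝ 2 φ) {M : ℝ}
    (hM : ∀ y, |φ y| ≤ M) (x : Euc d) {p : ℝ} (hp1 : 1 ≤ p) (hp2 : p ≤ 2) :
    ∃ R : ℝ, 0 ≤ R ∧ ∀ z, |levyIncrement φ x z| ≤ R * min 1 (‖z‖ ^ p) := by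
  have hM0 : 0 ≤ M := (abs_nonneg _).trans (hM x)
  have hd : ContDiff ℝ 1 (fderiv ℝ φ) := hφ.fderiv_right (by norm_num)
  obtain ⟨K, t, ht, hK⟩ := hd.contDiffAt.exists_lipschitzOnWith (x := x)
  obtain ⟨ρ, hρ, hρt⟩ := Metric.mem_nhds_iff.1 ht
  set ρ' := min ρ 1 with hρ'
  have hρ'0 : 0 < ρ' := lt_min hρ one_pos
  have hρ'1 : ρ' ≤ 1 := min_le_right _ _
  have hloc : ∀ z : Euc d, ‖z‖ < ρ' → |φ (x + z) - φ x - fderiv ℝ φ x z| ≤ K * ‖z‖ ^ 2 := by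
    intro z hz
    have hseg : ∀ y ∈ ball x ρ' ∩ closedBall x ‖z‖,
        ‖fderiv ℝ φ y - fderiv ℝ φ x‖ ≤ K * ‖z‖ := by
      intro y hy
      have h1 := hK.dist_le_mul y (hρt (ball_subset_ball (min_le_left _ _) hy.1)) x
        (hρt (mem_ball_self hρ))
      rw [dist_eq_norm] at h1
      exact h1.trans (mul_le_mul_of_nonneg_left hy.2 K.2)
    have := Convex.norm_image_sub_le_of_norm_hasFDerivWithin_le'
      (s := ball x ρ' ∩ closedBall x ‖z‖) (f := φ) (f' := fderiv ℝ φ) (φ := fderiv ℝ φ x)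
      (x := x) (y := x + z) (C := K * ‖z‖)
      (fun y _ => ((hφ.differentiable (by norm_num)) y).hasFDerivAt.hasFDerivWithinAt) hseg
      ((convex_ball _ _).inter (convex_closedBall _ _))
      ⟨mem_ball_self hρ'0, mem_closedBall_self (norm_nonneg _)⟩ ⟨by simpa using hz, by simp⟩
    rw [add_sub_cancel_left, Real.norm_eq_abs] at this
    exact this.trans_eq (by ring)
  have hQ : ∀ z, |fderiv ℝ φ x z| ≤ ‖fderiv ℝ φ x‖ * ‖z‖ := fun z =>
    (fderiv ℝ φ x).le_opNorm z
  have hbig : ∀ z : Euc d, ‖z‖ < 1 →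
      |φ (x + z) - φ x - fderiv ℝ φ x z| ≤ 2 * M + ‖fderiv ℝ φ x‖ := by
    intro z hz
    have h1 := abs_le.1 (hM (x + z))
    have h2 := abs_le.1 (hM x)
    have h3 := abs_le.1 ((hQ z).trans (mul_le_of_le_one_right (norm_nonneg _) hz.le))
    rw [abs_le]
    constructor <;> linarith
  have hρp : 0 < ρ' ^ p := Real.rpow_pos_of_pos hρ'0 p
  refine ⟨K + (2 * M + ‖fderiv ℝ φ x‖) / ρ' ^ p + 2 * M, by positivity, fun z => ?_⟩
  have hK0 : (0 : ℝ) ≤ K := K.2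
  have hA : 0 ≤ (2 * M + ‖fderiv ℝ φ x‖) / ρ' ^ p := by positivity
  rcases lt_or_ge ‖z‖ 1 with hz | hz
  · have hzp : ‖z‖ ^ p ≤ 1 := Real.rpow_le_one (norm_nonneg _) hz.le (by linarith)
    have hzp0 : 0 ≤ ‖z‖ ^ p := by positivity
    rw [min_eq_right hzp, levyIncrement, Set.indicator_of_mem (by simpa using hz)]
    rcases lt_or_ge ‖z‖ ρ' with hz' | hz'
    · have h2 : ‖z‖ ^ 2 ≤ ‖z‖ ^ p := by
        rw [← Real.rpow_natCast]
        exact Real.rpow_le_rpow_of_exponent_ge' (norm_nonneg _) hz.le (by linarith)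
          (by exact_mod_cast hp2)
      have := hloc z hz'
      nlinarith
    · have h2 : ρ' ^ p ≤ ‖z‖ ^ p := Real.rpow_le_rpow hρ'0.le hz' (by linarith)
      have := hbig z hz
      have h3 : 2 * M + ‖fderiv ℝ φ x‖ ≤ (2 * M + ‖fderiv ℝ φ x‖) / ρ' ^ p * ‖z‖ ^ p := by
        rw [div_mul_eq_mul_div, le_div_iff₀ hρp]
        gcongr
      nlinarith
  · have hzp : 1 ≤ ‖z‖ ^ p := Real.one_le_rpow hz (by linarith)
    rw [min_eq_left hzp, levyIncrement, Set.indicator_of_notMem (by simpa using hz)]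
    have h1 := abs_le.1 (hM (x + z))
    have h2 := abs_le.1 (hM x)
    rw [abs_le]
    constructor <;> linarith

lemma measurable_levyIncrement {φ : Euc d → ℝ} (hφ : Continuous φ) (x : Euc d) :
    Measurable (levyIncrement φ x) := by
  unfold levyIncrement
  refine ((hφ.comp (continuous_const.add continuous_id)).measurable.sub measurable_const).sub ?_
  exact (fderiv ℝ φ x).continuous.measurable.indicator measurableSet_ball

lemma measurable_min_one_norm_rpow (p : ℝ) :
    Measurable fun z : Euc d => min 1 (‖z‖ ^ p) := by
  fun_prop

lemma IsLevyLp.integrable_min {p : ℝ} {μ : Measure (Euc d)} (h : IsLevyLp p μ) :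
    Integrable (fun z => min 1 (‖z‖ ^ p)) μ := by
  refine ⟨(measurable_min_one_norm_rpow p).aestronglyMeasurable, ?_⟩
  rw [hasFiniteIntegral_iff_ofReal (ae_of_all _ fun z => by positivity)]
  exact h.2

lemma integral_min_le {p Λ : ℝ} {μ : Measure (Euc d)} (hΛ : 0 ≤ Λ)
    (h : ∫⁻ z, ENNReal.ofReal (min 1 (‖z‖ ^ p)) ∂μ ≤ ENNReal.ofReal Λ) :
    ∫ z, min 1 (‖z‖ ^ p) ∂μ ≤ Λ := by
  rw [integral_eq_lintegral_of_nonneg_ae (ae_of_all _ fun z => by positivity)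
    (measurable_min_one_norm_rpow p).aestronglyMeasurable]
  exact ENNReal.toReal_le_of_le_ofReal hΛ h

lemma IsLevyLp.integrable_levyIncrement {p : ℝ} {μ : Measure (Euc d)} (h : IsLevyLp p μ)
    (hp1 : 1 ≤ p) (hp2 : p ≤ 2) {φ : Euc d → ℝ} (hφ : ContDiff ℝ 2 φ)
    (hM : ∃ M, ∀ y, |φ y| ≤ M) (x : Euc d) : Integrable (levyIncrement φ x) μ := by
  obtain ⟨M, hM⟩ := hM
  obtain ⟨R, -, hR⟩ := exists_levyIncrement_bound hφ hM x hp1 hp2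
  exact (h.integrable_min.const_mul R).mono'
    (measurable_levyIncrement hφ.continuous x).aestronglyMeasurable (ae_of_all _ hR)

lemma exists_abs_Lop_le {p Λ : ℝ} (hΛ : 0 ≤ Λ) (hp1 : 1 ≤ p) (hp2 : p ≤ 2) {φ : Euc d → ℝ}
    (hφ : ContDiff ℝ 2 φ) (hM : ∃ M, ∀ y, |φ y| ≤ M) (x : Euc d) :
    ∃ R : ℝ, ∀ μ : Measure (Euc d), IsLevyLp p μ →
      ∫⁻ z, ENNReal.ofReal (min 1 (‖z‖ ^ p)) ∂μ ≤ ENNReal.ofReal Λ → |Lop μ φ x| ≤ R := by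
  obtain ⟨M, hM⟩ := hM
  obtain ⟨R, hR0, hR⟩ := exists_levyIncrement_bound hφ hM x hp1 hp2
  refine ⟨R * Λ, fun μ hμ hμΛ => ?_⟩
  calc |Lop μ φ x| ≤ ∫ z, R * min 1 (‖z‖ ^ p) ∂μ :=
        norm_integral_le_of_norm_le (f := levyIncrement φ x)
          (hμ.integrable_min.const_mul R) (ae_of_all _ hR)
    _ = R * ∫ z, min 1 (‖z‖ ^ p) ∂μ := integral_const_mul _ _
    _ ≤ R * Λ := mul_le_mul_of_nonneg_left (integral_min_le hΛ hμΛ) hR0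

lemma nonpos_of_iSup_iInf_gap [Nonempty A] [Nonempty B] {F G : A → B → ℝ} {R k : ℝ}
    (hF : ∀ α β, |F α β| ≤ R) (hG : ∀ α β, |G α β| ≤ R) (hFG : ∀ α β, G α β + k ≤ F α β)
    (hF0 : ⨆ α, ⨅ β, F α β ≤ 0) (hG0 : 0 ≤ ⨆ α, ⨅ β, G α β) : k ≤ 0 := by
  have bF : ∀ α, BddBelow (Set.range (F α)) := fun α =>
    ⟨-R, by rintro _ ⟨β, rfl⟩; exact (abs_le.1 (hF α β)).1⟩
  have bG : ∀ α, BddBelow (Set.range (G α)) := fun α =>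
    ⟨-R, by rintro _ ⟨β, rfl⟩; exact (abs_le.1 (hG α β)).1⟩
  have bS : BddAbove (Set.range fun α => ⨅ β, F α β) := by
    refine ⟨R, ?_⟩
    rintro _ ⟨α, rfl⟩
    obtain ⟨β⟩ := ‹Nonempty B›
    exact (ciInf_le (bF α) β).trans (abs_le.1 (hF α β)).2
  have : ⨆ α, ⨅ β, G α β ≤ -k := by
    refine ciSup_le fun α => ?_
    have h1 : ⨅ β, F α β ≤ 0 := (le_ciSup bS α).trans hF0
    have h2 : (⨅ β, G α β) + k ≤ ⨅ β, F α β := by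
      refine le_ciInf fun β => ?_
      have := ciInf_le (bG α) β
      linarith [hFG α β]
    linarith
  linarith

lemma AdmPlan.integral_comp_eq {μ : Measure (Euc d)} {X : Type*} [MeasurableSpace X]
    {γ : Measure X} {π : X → Euc d} (hπ : Measurable π)
    (h : (γ.map π).restrict {(0 : Euc d)}ᶜ = μ) {F : Euc d → ℝ} (hFm : Measurable F)
    (hF : Integrable F μ) (hF0 : F 0 = 0) :
    Integrable (fun q => F (π q)) γ ∧ ∫ q, F (π q) ∂γ = ∫ z, F z ∂μ := by
  have hsupp : Function.support F ⊆ {(0 : Euc d)}ᶜ := by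
    intro z hz hz0
    rw [Set.mem_singleton_iff] at hz0
    exact hz (hz0 ▸ hF0)
  subst h
  have hint : Integrable F (γ.map π) := (integrableOn_iff_integrable_of_support_subset hsupp).1 hF
  refine ⟨hint.comp_measurable hπ, ?_⟩
  rw [setIntegral_eq_integral_of_forall_compl_eq_zero
    (fun z hz => by_contra fun hne => hz (hsupp hne)),
    integral_map hπ.aemeasurable hFm.aestronglyMeasurable]

/-- The easy direction of Kantorovich duality. -/
lemma integral_sub_integral_le_dLpPow {p K : ℝ} {μ ν : Measure (Euc d)} {F G : Euc d → ℝ}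
    (hK : 0 ≤ K) (hFm : Measurable F) (hGm : Measurable G) (hF : Integrable F μ)
    (hG : Integrable G ν) (hF0 : F 0 = 0) (hG0 : G 0 = 0)
    (hle : ∀ z w, F z - G w ≤ K * ‖z - w‖ ^ p) (hfin : dLpPow p μ ν < ⊤) :
    ∫ z, F z ∂μ - ∫ w, G w ∂ν ≤ K * (dLpPow p μ ν).toReal := by
  have key : ∀ e : ℝ, 0 < e →
      ∫ z, F z ∂μ - ∫ w, G w ∂ν ≤ K * ((dLpPow p μ ν).toReal + e) := by
    intro e he
    have hlt : dLpPow p μ ν < dLpPow p μ ν + ENNReal.ofReal e :=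
      ENNReal.lt_add_right hfin.ne (by simpa using he)
    obtain ⟨γ, hγ, hJ⟩ : ∃ γ ∈ AdmPlan μ ν, Jp p γ < dLpPow p μ ν + ENNReal.ofReal e := by
      simpa [dLpPow, iInf_lt_iff] using hlt
    have hbd : dLpPow p μ ν + ENNReal.ofReal e < ⊤ :=
      ENNReal.add_lt_top.2 ⟨hfin, ENNReal.ofReal_lt_top⟩
    have hcm : Measurable fun q : Euc d × Euc d => ‖q.1 - q.2‖ ^ p := by fun_prop
    have hc0 : ∀ q : Euc d × Euc d, 0 ≤ ‖q.1 - q.2‖ ^ p := fun q => by positivity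
    have hci : Integrable (fun q : Euc d × Euc d => ‖q.1 - q.2‖ ^ p) γ := by
      refine ⟨hcm.aestronglyMeasurable, ?_⟩
      rw [hasFiniteIntegral_iff_ofReal (ae_of_all _ hc0)]
      exact hJ.trans hbd
    have hcval : ∫ q, ‖q.1 - q.2‖ ^ p ∂γ ≤ (dLpPow p μ ν).toReal + e := by
      rw [integral_eq_lintegral_of_nonneg_ae (ae_of_all _ hc0) hcm.aestronglyMeasurable]
      refine (ENNReal.toReal_mono hbd.ne hJ.le).trans_eq ?_
      rw [ENNReal.toReal_add hfin.ne ENNReal.ofReal_ne_top, ENNReal.toReal_ofReal he.le]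
    obtain ⟨-, h1, h2⟩ := hγ
    obtain ⟨iF, eF⟩ := AdmPlan.integral_comp_eq measurable_fst h1 hFm hF hF0
    obtain ⟨iG, eG⟩ := AdmPlan.integral_comp_eq measurable_snd h2 hGm hG hG0
    rw [← eF, ← eG, ← integral_sub iF iG]
    calc ∫ q, (F q.1 - G q.2) ∂γ ≤ ∫ q, K * ‖q.1 - q.2‖ ^ p ∂γ :=
          integral_mono (iF.sub iG) (hci.const_mul K) fun q => hle q.1 q.2
      _ = K * ∫ q, ‖q.1 - q.2‖ ^ p ∂γ := integral_const_mul _ _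
      _ ≤ _ := mul_le_mul_of_nonneg_left hcval hK
  refine le_of_forall_pos_le_add fun e he => ?_
  have := key (e / (K + 1)) (by positivity)
  have h2 : K * (e / (K + 1)) ≤ e := by
    rw [mul_div_assoc', div_le_iff₀ (by positivity)]
    nlinarith
  linarith

lemma dLpPow_lt_top {p : ℝ} {μ ν : Measure (Euc d)} (hμ0 : μ {0} = 0) (hν0 : ν {0} = 0)
    (hμ : ∫⁻ z, ENNReal.ofReal (‖z‖ ^ p) ∂μ < ⊤) (hν : ∫⁻ z, ENNReal.ofReal (‖z‖ ^ p) ∂ν < ⊤) :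
    dLpPow p μ ν < ⊤ := by
  have ml : Measurable fun z : Euc d => (z, (0 : Euc d)) := by fun_prop
  have mr : Measurable fun z : Euc d => ((0 : Euc d), z) := by fun_prop
  have hr : ∀ {ρ : Measure (Euc d)}, ρ {0} = 0 → ρ.restrict {(0 : Euc d)}ᶜ = ρ := fun {ρ} h =>
    Measure.restrict_eq_self_of_ae_mem (compl_mem_ae_iff.2 h)
  have hz : ∀ {ρ : Measure (Euc d)},
      (ρ.map fun _ => (0 : Euc d)).restrict {(0 : Euc d)}ᶜ = 0 := fun {ρ} => by
    rw [Measure.map_const, Measure.restrict_smul,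
      Measure.restrict_eq_zero.2 (by simp), smul_zero]
  have hadm : μ.map (fun z => (z, (0 : Euc d))) + ν.map (fun z => ((0 : Euc d), z))
      ∈ AdmPlan μ ν := by
    refine ⟨?_, ?_, ?_⟩
    · rw [Measure.add_apply, Measure.map_apply ml (measurableSet_singleton _),
        Measure.map_apply mr (measurableSet_singleton _)]
      have e1 : (fun z : Euc d => (z, (0 : Euc d))) ⁻¹' {(0, 0)} = {0} := by ext; simp
      have e2 : (fun z : Euc d => ((0 : Euc d), z)) ⁻¹' {(0, 0)} = {0} := by ext; simp
      rw [e1, e2, hμ0, hν0, add_zero]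
    · rw [Measure.map_add _ _ measurable_fst, Measure.map_map measurable_fst ml,
        Measure.map_map measurable_fst mr, Measure.restrict_add]
      have e1 : (Prod.fst ∘ fun z : Euc d => (z, (0 : Euc d))) = id := rfl
      have e2 : (Prod.fst ∘ fun z : Euc d => ((0 : Euc d), z)) = fun _ => 0 := rfl
      rw [e1, e2, Measure.map_id, hr hμ0, hz, add_zero]
    · rw [Measure.map_add _ _ measurable_snd, Measure.map_map measurable_snd ml,
        Measure.map_map measurable_snd mr, Measure.restrict_add]
      have e1 : (Prod.snd ∘ fun z : Euc d => (z, (0 : Euc d))) = fun _ => 0 := rfl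
      have e2 : (Prod.snd ∘ fun z : Euc d => ((0 : Euc d), z)) = id := rfl
      rw [e1, e2, Measure.map_id, hr hν0, hz, zero_add]
  refine (iInf₂_le _ hadm).trans_lt ?_
  have hcm : Measurable fun q : Euc d × Euc d => ENNReal.ofReal (‖q.1 - q.2‖ ^ p) := by fun_prop
  rw [Jp, lintegral_add_measure, lintegral_map hcm ml, lintegral_map hcm mr]
  simpa using ⟨hμ, hν⟩

lemma integral_sub_integral_le_of_le {X : Type*} [MeasurableSpace X] {μ ν : Measure X}
    [IsFiniteMeasure μ] [IsFiniteMeasure ν] (h : ν ≤ μ) {g : X → ℝ} (hg : Measurable g) {M : ℝ}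
    (hM : ∀ x, |g x| ≤ M) :
    |∫ x, g x ∂μ - ∫ x, g x ∂ν| ≤ M * (μ Set.univ - ν Set.univ).toReal := by
  have hi : ∀ ρ : Measure X, [IsFiniteMeasure ρ] → Integrable g ρ := fun ρ _ =>
    Integrable.of_bound hg.aestronglyMeasurable M (ae_of_all _ hM)
  have e : μ - ν + ν = μ := Measure.sub_add_cancel_of_le h
  have e2 : ∫ x, g x ∂μ = ∫ x, g x ∂(μ - ν) + ∫ x, g x ∂ν := by
    rw [← integral_add_measure (hi _) (hi _), e]
  rw [e2, add_sub_cancel_right, ← Measure.sub_apply MeasurableSet.univ h]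
  exact norm_integral_le_of_norm_le_const (f := g) (ae_of_all _ hM)

lemma integral_sub_integral_le_dTV {X : Type*} [MeasurableSpace X] {μ ν : Measure X}
    [IsFiniteMeasure μ] [IsFiniteMeasure ν] {g : X → ℝ} (hg : Measurable g) {M : ℝ} (hM0 : 0 ≤ M)
    (hM : ∀ x, |g x| ≤ M) {t : ℝ} (ht : 0 ≤ t) (hTV : dTV μ ν ≤ ENNReal.ofReal t) :
    ∫ x, g x ∂μ - ∫ x, g x ∂ν ≤ M * t := by
  obtain ⟨S, hS⟩ := exists_isHahnDecomposition μ ν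
  have hi : ∀ ρ : Measure X, [IsFiniteMeasure ρ] → Integrable g ρ := fun ρ _ =>
    Integrable.of_bound hg.aestronglyMeasurable M (ae_of_all _ hM)
  have h1 := integral_sub_integral_le_of_le hS.le_on hg hM
  have h2 := integral_sub_integral_le_of_le hS.ge_on_compl hg hM
  simp only [Measure.restrict_apply MeasurableSet.univ, Set.univ_inter] at h1 h2
  have hle : (μ Sᶜ - ν Sᶜ) + (ν S - μ S) ≤ ENNReal.ofReal t := by
    refine le_trans ?_ hTV
    exact add_le_add (le_iSup₂_of_le (f := fun s (_ : MeasurableSet s) => μ s - ν s) Sᶜ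
      hS.measurableSet.compl le_rfl)
      (le_iSup₂_of_le (f := fun s (_ : MeasurableSet s) => ν s - μ s) S hS.measurableSet le_rfl)
  have h3 : (μ Sᶜ - ν Sᶜ).toReal + (ν S - μ S).toReal ≤ t := by
    rw [← ENNReal.toReal_add (ENNReal.sub_ne_top (measure_ne_top _ _))
      (ENNReal.sub_ne_top (measure_ne_top _ _))]
    exact ENNReal.toReal_le_of_le_ofReal ht hle
  rw [← integral_add_compl hS.measurableSet (hi μ), ← integral_add_compl hS.measurableSet (hi ν)]
  have h1' := (abs_le.1 h1).1
  have h2' := (abs_le.1 h2).2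
  have := mul_le_mul_of_nonneg_left h3 hM0
  linarith

lemma lintegral_ball_le_lintegral_min {p : ℝ} (hp : 1 ≤ p) (μ : Measure (Euc d)) :
    ∫⁻ z in ball (0 : Euc d) 1, ENNReal.ofReal (‖z‖ ^ p) ∂μ
      ≤ ∫⁻ z, ENNReal.ofReal (min 1 (‖z‖ ^ p)) ∂μ := by
  refine le_trans (setLIntegral_mono' measurableSet_ball fun z hz => ?_)
    (setLIntegral_le_lintegral _ _)
  rw [mem_ball_zero_iff] at hz
  rw [min_eq_right (Real.rpow_le_one (norm_nonneg _) hz.le (by linarith))]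

lemma IsLevyLp.isFiniteMeasure_restrict_compl_ball {p : ℝ} (hp : 1 ≤ p) {μ : Measure (Euc d)}
    (h : IsLevyLp p μ) : IsFiniteMeasure (μ.restrict (ball (0 : Euc d) 1)ᶜ) := by
  refine ⟨?_⟩
  rw [Measure.restrict_apply_univ, ← setLIntegral_one]
  refine lt_of_le_of_lt ?_ h.2
  refine le_trans (setLIntegral_mono' measurableSet_ball.compl fun z hz => ?_)
    (setLIntegral_le_lintegral _ _)
  have hz1 : 1 ≤ ‖z‖ := by simpa using hz
  rw [min_eq_left (Real.one_le_rpow hz1 (by linarith)), ENNReal.ofReal_one]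

/-- The error made near the origin when a bounded uniformly continuous function is replaced by a
smooth test function. -/
def levyError (p K δ η : ℝ) (z : Euc d) : ℝ :=
  (ball (0 : Euc d) (2 * δ)).indicator (fun w => K * ‖w‖ ^ p) z + η * min 1 (‖z‖ ^ p)

lemma measurable_levyError (p K δ η : ℝ) : Measurable (levyError (d := d) p K δ η) := by
  unfold levyError
  refine Measurable.add (Measurable.indicator (by fun_prop) measurableSet_ball) (by fun_prop)

lemma levyError_nonneg {p K δ η : ℝ} (hK : 0 ≤ K) (hη : 0 ≤ η) (z : Euc d) :
    0 ≤ levyError p K δ η z := by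
  refine add_nonneg (Set.indicator_nonneg (fun w _ => by positivity) z) (by positivity)

lemma integrable_levyError {p K δ η τ Λ : ℝ} (hK : 0 ≤ K) (hη : 0 ≤ η) (hτ : 0 ≤ τ) (hΛ : 0 ≤ Λ)
    {μ : Measure (Euc d)} (hμ : IsLevyLp p μ)
    (hμτ : ∫⁻ z in ball (0 : Euc d) (2 * δ), ENNReal.ofReal (‖z‖ ^ p) ∂μ ≤ ENNReal.ofReal τ)
    (hμΛ : ∫⁻ z, ENNReal.ofReal (min 1 (‖z‖ ^ p)) ∂μ ≤ ENNReal.ofReal Λ) :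
    Integrable (levyError p K δ η) μ ∧ ∫ z, levyError p K δ η z ∂μ ≤ K * τ + η * Λ := by
  have hm : Measurable fun z : Euc d => ‖z‖ ^ p := by fun_prop
  have h0 : ∀ z : Euc d, 0 ≤ ‖z‖ ^ p := fun z => by positivity
  have i1 : IntegrableOn (fun z : Euc d => ‖z‖ ^ p) (ball 0 (2 * δ)) μ := by
    refine ⟨hm.aestronglyMeasurable, ?_⟩
    rw [hasFiniteIntegral_iff_ofReal (ae_of_all _ h0)]
    exact hμτ.trans_lt ENNReal.ofReal_lt_top
  have e1 : ∫ z in ball (0 : Euc d) (2 * δ), ‖z‖ ^ p ∂μ ≤ τ := by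
    rw [integral_eq_lintegral_of_nonneg_ae (ae_of_all _ h0) hm.aestronglyMeasurable]
    exact ENNReal.toReal_le_of_le_ofReal hτ hμτ
  have i2 : Integrable ((ball (0 : Euc d) (2 * δ)).indicator fun w => K * ‖w‖ ^ p) μ :=
    (integrable_indicator_iff measurableSet_ball).2 (i1.const_mul K)
  have i3 := hμ.integrable_min.const_mul η
  refine ⟨i2.add i3, ?_⟩
  unfold levyError
  rw [integral_add i2 i3, integral_indicator measurableSet_ball, integral_const_mul,
    integral_const_mul]
  exact add_le_add (mul_le_mul_of_nonneg_left e1 hK)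
    (mul_le_mul_of_nonneg_left (integral_min_le hΛ hμΛ) hη)

lemma increment_sub_le {p K δ η : ℝ} (hp1 : 1 ≤ p) (hp2 : p ≤ 2) (hK : 0 ≤ K)
    {a b U V : Euc d → ℝ} (hab : ∀ z w, a z - b w ≤ K * ‖z - w‖ ^ p)
    (hU1 : ∀ z, U z ≤ K * ‖z‖ ^ p + η * min 1 (‖z‖ ^ p))
    (hU2 : ∀ z, δ ≤ ‖z‖ → U z ≤ a z + η * min 1 (‖z‖ ^ p))
    (hV1 : ∀ z, -(K * ‖z‖ ^ p + η * min 1 (‖z‖ ^ p)) ≤ V z)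
    (hV2 : ∀ z, δ ≤ ‖z‖ → b z - η * min 1 (‖z‖ ^ p) ≤ V z) (z w : Euc d) :
    (U z - levyError p K δ η z) - (V w + levyError p K δ η w) ≤ 4 * K * ‖z - w‖ ^ p := by
  have hd0 : 0 ≤ K * ‖z - w‖ ^ p := by positivity
  have far : ∀ q : Euc d, ‖q‖ ≤ 2 * ‖z - w‖ → K * ‖q‖ ^ p ≤ 4 * (K * ‖z - w‖ ^ p) := by
    intro q hq
    have h1 := Real.rpow_le_rpow (norm_nonneg _) hq (z := p) (by linarith)
    rw [Real.mul_rpow (by norm_num) (norm_nonneg _)] at h1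
    have h2 : (2 : ℝ) ^ p ≤ 4 := by
      calc (2 : ℝ) ^ p ≤ 2 ^ (2 : ℝ) := Real.rpow_le_rpow_of_exponent_le (by norm_num) hp2
        _ = 4 := by norm_num
    have h3 : ‖q‖ ^ p ≤ 4 * ‖z - w‖ ^ p :=
      h1.trans (mul_le_mul_of_nonneg_right h2 (by positivity))
    nlinarith
  have ind0 : ∀ q : Euc d, 0 ≤ (ball (0 : Euc d) (2 * δ)).indicator (fun w => K * ‖w‖ ^ p) q :=
    fun q => Set.indicator_nonneg (fun w _ => by positivity) q
  have ind1 : ∀ q : Euc d, ‖q‖ < 2 * δ →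
      (ball (0 : Euc d) (2 * δ)).indicator (fun w => K * ‖w‖ ^ p) q = K * ‖q‖ ^ p :=
    fun q hq => Set.indicator_of_mem (by simpa using hq) _
  have near : ∀ q : Euc d, (‖q‖ < 2 * δ ∨ ‖q‖ ≤ 2 * ‖z - w‖) → K * ‖q‖ ^ p ≤
      4 * (K * ‖z - w‖ ^ p) + (ball (0 : Euc d) (2 * δ)).indicator (fun w => K * ‖w‖ ^ p) q := by
    rintro q (hq | hq)
    · rw [ind1 q hq]; linarith
    · linarith [far q hq, ind0 q]
  have tri1 : ‖z‖ ≤ ‖w‖ + ‖z - w‖ := by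
    have := norm_add_le w (z - w); rwa [add_sub_cancel] at this
  have tri2 : ‖w‖ ≤ ‖z‖ + ‖z - w‖ := by
    have := norm_sub_le z (z - w); rwa [sub_sub_cancel] at this
  unfold levyError
  rcases lt_or_ge ‖z‖ δ with hz | hz
  · have hδ0 : 0 < δ := (norm_nonneg _).trans_lt hz
    have e := ind1 z (by linarith)
    have := near w (by by_contra! hc; linarith [hc.1, hc.2])
    linarith [hU1 z, hV1 w]
  · rcases lt_or_ge ‖w‖ δ with hw | hw
    · have e := ind1 w (by linarith [norm_nonneg w])
      have := near z (by by_contra! hc; linarith [hc.1, hc.2])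
      linarith [hU1 z, hV1 w]
    · linarith [hU2 z hz, hV2 w hw, hab z w, ind0 z, ind0 w]

lemma Lop_sub_Lop_le {p K δ η τ Λ M t : ℝ} (hp1 : 1 ≤ p) (hp2 : p ≤ 2) (hK : 0 ≤ K)
    (hδ1 : δ ≤ 1) (hη : 0 ≤ η) (hτ : 0 ≤ τ) (hΛ : 0 ≤ Λ) (ht : 0 ≤ t)
    {μ ν : Measure (Euc d)} (hμ : IsLevyLp p μ) (hν : IsLevyLp p ν)
    (hμτ : ∫⁻ z in ball (0 : Euc d) (2 * δ), ENNReal.ofReal (‖z‖ ^ p) ∂μ ≤ ENNReal.ofReal τ)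
    (hντ : ∫⁻ z in ball (0 : Euc d) (2 * δ), ENNReal.ofReal (‖z‖ ^ p) ∂ν ≤ ENNReal.ofReal τ)
    (hμΛ : ∫⁻ z, ENNReal.ofReal (min 1 (‖z‖ ^ p)) ∂μ ≤ ENNReal.ofReal Λ)
    (hνΛ : ∫⁻ z, ENNReal.ofReal (min 1 (‖z‖ ^ p)) ∂ν ≤ ENNReal.ofReal Λ)
    (hTV : dTV (μ.restrict (ball (0 : Euc d) 1)ᶜ) (ν.restrict (ball (0 : Euc d) 1)ᶜ)
      ≤ ENNReal.ofReal t)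
    {u v φ φ' : Euc d → ℝ} {x y : Euc d} {Q : Euc d →L[ℝ] ℝ} (hv : Continuous v)
    (hvM : ∀ y, |v y| ≤ M)
    (hmax : ∀ z w, (u (x + z) - u x - Q z) - (v (y + w) - v y - Q w) ≤ K * ‖z - w‖ ^ p)
    (hφ : ContDiff ℝ 2 φ) (hφb : ∃ M, ∀ y, |φ y| ≤ M) (hφx : φ x = u x)
    (hφQ : fderiv ℝ φ x = Q)
    (hφ' : ContDiff ℝ 2 φ') (hφb' : ∃ M, ∀ y, |φ' y| ≤ M) (hφy : φ' y = v y)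
    (hφQ' : fderiv ℝ φ' y = Q)
    (hU1 : ∀ z, φ (x + z) - φ x - Q z ≤ K * ‖z‖ ^ p + η * min 1 (‖z‖ ^ p))
    (hU2 : ∀ z, δ ≤ ‖z‖ → φ (x + z) ≤ u (x + z) + η * min 1 (‖z‖ ^ p))
    (hV1 : ∀ z, -(K * ‖z‖ ^ p + η * min 1 (‖z‖ ^ p)) ≤ φ' (y + z) - φ' y - Q z)
    (hV2 : ∀ z, δ ≤ ‖z‖ → v (y + z) - η * min 1 (‖z‖ ^ p) ≤ φ' (y + z)) :
    Lop μ φ x - Lop ν φ' y ≤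
      4 * K * (dLpPow p (μ.restrict (ball (0 : Euc d) 1)) (ν.restrict (ball (0 : Euc d) 1))).toReal
        + 2 * (K * τ + η * Λ) + 2 * (η * Λ) + 2 * M * t := by
  have hM0 : 0 ≤ M := (abs_nonneg _).trans (hvM y)
  have hp0 : p ≠ 0 := by linarith
  set D := dLpPow p (μ.restrict (ball (0 : Euc d) 1)) (ν.restrict (ball (0 : Euc d) 1)) with hD
  have hDfin : D < ⊤ := by
    refine dLpPow_lt_top ?_ ?_ ((lintegral_ball_le_lintegral_min hp1 μ).trans_lt hμ.2)
      ((lintegral_ball_le_lintegral_min hp1 ν).trans_lt hν.2)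
    · exact le_antisymm ((Measure.restrict_apply_le _ _).trans_eq hμ.1) bot_le
    · exact le_antisymm ((Measure.restrict_apply_le _ _).trans_eq hν.1) bot_le
  have i1 := hμ.integrable_levyIncrement hp1 hp2 hφ hφb x
  have i2 := hν.integrable_levyIncrement hp1 hp2 hφ' hφb' y
  obtain ⟨j1, e1⟩ := integrable_levyError hK hη hτ hΛ hμ hμτ hμΛ
  obtain ⟨j2, e2⟩ := integrable_levyError hK hη hτ hΛ hν hντ hνΛ
  have s1 : Lop μ φ x = ∫ z in ball (0 : Euc d) 1, levyIncrement φ x z ∂μ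
      + ∫ z in (ball (0 : Euc d) 1)ᶜ, levyIncrement φ x z ∂μ :=
    (integral_add_compl measurableSet_ball i1).symm
  have s2 : Lop ν φ' y = ∫ z in ball (0 : Euc d) 1, levyIncrement φ' y z ∂ν
      + ∫ z in (ball (0 : Euc d) 1)ᶜ, levyIncrement φ' y z ∂ν :=
    (integral_add_compl measurableSet_ball i2).symm
  have inn1 : ∀ z ∈ ball (0 : Euc d) 1, levyIncrement φ x z = φ (x + z) - φ x - Q z := by
    intro z hz
    rw [levyIncrement, Set.indicator_of_mem hz, hφQ]
  have inn2 : ∀ z ∈ ball (0 : Euc d) 1, levyIncrement φ' y z = φ' (y + z) - φ' y - Q z := by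
    intro z hz
    rw [levyIncrement, Set.indicator_of_mem hz, hφQ']
  have out1 : ∀ z ∈ (ball (0 : Euc d) 1)ᶜ, levyIncrement φ x z = φ (x + z) - φ x := by
    intro z hz
    rw [levyIncrement, Set.indicator_of_notMem hz, sub_zero]
  have out2 : ∀ z ∈ (ball (0 : Euc d) 1)ᶜ, levyIncrement φ' y z = φ' (y + z) - φ' y := by
    intro z hz
    rw [levyIncrement, Set.indicator_of_notMem hz, sub_zero]
  have near : ∫ z in ball (0 : Euc d) 1, levyIncrement φ x z ∂μ
      - ∫ z in ball (0 : Euc d) 1, levyIncrement φ' y z ∂ν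
      ≤ 4 * K * D.toReal + 2 * (K * τ + η * Λ) := by
    have cont1 : Continuous fun z => φ (x + z) - φ x - Q z :=
      ((hφ.continuous.comp (continuous_const.add continuous_id)).sub continuous_const).sub
        Q.continuous
    have cont2 : Continuous fun z => φ' (y + z) - φ' y - Q z :=
      ((hφ'.continuous.comp (continuous_const.add continuous_id)).sub continuous_const).sub
        Q.continuous
    have k1 : IntegrableOn (fun z => φ (x + z) - φ x - Q z) (ball 0 1) μ :=
      i1.integrableOn.congr_fun inn1 measurableSet_ball
    have k2 : IntegrableOn (fun z => φ' (y + z) - φ' y - Q z) (ball 0 1) ν :=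
      i2.integrableOn.congr_fun inn2 measurableSet_ball
    have err0 : levyError p K δ η (0 : Euc d) = 0 := by
      have : (ball (0 : Euc d) (2 * δ)).indicator (fun w => K * ‖w‖ ^ p) 0 = 0 := by
        rw [Set.indicator_apply_eq_zero]
        intro _
        rw [norm_zero, Real.zero_rpow hp0, mul_zero]
      rw [levyError, this, norm_zero, Real.zero_rpow hp0]
      simp
    have key := integral_sub_integral_le_dLpPow (p := p) (K := 4 * K)
      (F := fun z => (φ (x + z) - φ x - Q z) - levyError p K δ η z)
      (G := fun z => (φ' (y + z) - φ' y - Q z) + levyError p K δ η z) (by positivity)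
      (cont1.measurable.sub (measurable_levyError p K δ η))
      (cont2.measurable.add (measurable_levyError p K δ η))
      (k1.sub j1.integrableOn) (k2.add j2.integrableOn) (by simp [err0]) (by simp [err0])
      (increment_sub_le hp1 hp2 hK hmax hU1
        (fun z hz => by have := hU2 z hz; rw [hφx]; linarith) hV1
        (fun z hz => by have := hV2 z hz; rw [hφy]; linarith)) hDfin
    rw [integral_sub k1 j1.integrableOn, integral_add k2 j2.integrableOn] at key
    have n1 := setIntegral_le_integral (s := ball (0 : Euc d) 1) j1
      (ae_of_all _ (levyError_nonneg hK hη))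
    have n2 := setIntegral_le_integral (s := ball (0 : Euc d) 1) j2
      (ae_of_all _ (levyError_nonneg hK hη))
    rw [setIntegral_congr_fun measurableSet_ball inn1, setIntegral_congr_fun measurableSet_ball inn2]
    linarith
  have far : ∫ z in (ball (0 : Euc d) 1)ᶜ, levyIncrement φ x z ∂μ
      - ∫ z in (ball (0 : Euc d) 1)ᶜ, levyIncrement φ' y z ∂ν ≤ 2 * (η * Λ) + 2 * M * t := by
    have := hμ.isFiniteMeasure_restrict_compl_ball hp1
    have := hν.isFiniteMeasure_restrict_compl_ball hp1
    have gm : Measurable fun z => v (y + z) - v y :=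
      ((hv.comp (continuous_const.add continuous_id)).sub continuous_const).measurable
    have gb : ∀ z, |v (y + z) - v y| ≤ 2 * M := fun z =>
      (abs_sub _ _).trans (by linarith [hvM (y + z), hvM y])
    have gi : ∀ ρ : Measure (Euc d), [IsFiniteMeasure ρ] →
        Integrable (fun z => v (y + z) - v y) ρ := fun ρ _ =>
      Integrable.of_bound gm.aestronglyMeasurable (2 * M) (ae_of_all _ gb)
    have tv := integral_sub_integral_le_dTV gm (by positivity) gb ht hTV
    have m1 := (hμ.integrable_min.const_mul η)
    have m2 := (hν.integrable_min.const_mul η)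
    have b1 : ∫ z in (ball (0 : Euc d) 1)ᶜ, levyIncrement φ x z ∂μ
        ≤ ∫ z in (ball (0 : Euc d) 1)ᶜ, ((v (y + z) - v y) + η * min 1 (‖z‖ ^ p)) ∂μ := by
      refine setIntegral_mono_on i1.integrableOn ((gi _).add m1.integrableOn)
        measurableSet_ball.compl fun z hz => ?_
      have hz1 : 1 ≤ ‖z‖ := by simpa using hz
      have h1 := hU2 z (hδ1.trans hz1)
      have h2 := hmax z z
      rw [sub_self, norm_zero, Real.zero_rpow hp0] at h2
      rw [out1 z hz, hφx]
      linarith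
    have b2 : ∫ z in (ball (0 : Euc d) 1)ᶜ, ((v (y + z) - v y) - η * min 1 (‖z‖ ^ p)) ∂ν
        ≤ ∫ z in (ball (0 : Euc d) 1)ᶜ, levyIncrement φ' y z ∂ν := by
      refine setIntegral_mono_on ((gi _).sub m2.integrableOn) i2.integrableOn
        measurableSet_ball.compl fun z hz => ?_
      have hz1 : 1 ≤ ‖z‖ := by simpa using hz
      have h1 := hV2 z (hδ1.trans hz1)
      rw [out2 z hz, hφy]
      linarith
    rw [integral_add (gi _) m1.integrableOn] at b1
    rw [integral_sub (gi _) m2.integrableOn] at b2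
    have n1 : ∫ z in (ball (0 : Euc d) 1)ᶜ, η * min 1 (‖z‖ ^ p) ∂μ ≤ η * Λ :=
      (setIntegral_le_integral m1 (ae_of_all _ fun z => by positivity)).trans
        (by rw [integral_const_mul]; exact mul_le_mul_of_nonneg_left (integral_min_le hΛ hμΛ) hη)
    have n2 : ∫ z in (ball (0 : Euc d) 1)ᶜ, η * min 1 (‖z‖ ^ p) ∂ν ≤ η * Λ :=
      (setIntegral_le_integral m2 (ae_of_all _ fun z => by positivity)).trans
        (by rw [integral_const_mul]; exact mul_le_mul_of_nonneg_left (integral_min_le hΛ hνΛ) hη)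
    linarith
  rw [s1, s2]
  linarith

lemma psiK_zero (p κ : ℝ) : psiK (d := d) p κ 0 = 0 := by simp [psiK]

lemma psiK_nonneg {p κ : ℝ} (hp : 0 ≤ p) (hκ : 0 < κ) (a : Euc d) : 0 ≤ psiK p κ a :=
  sub_nonneg.2 (Real.rpow_le_rpow hκ.le (by linarith [sq_nonneg ‖a‖]) (by linarith))

lemma exists_doubling_max {O : Set (Euc d)} (hO : Bornology.IsBounded O) {u v Ψ : Euc d → ℝ}
    (hu : Continuous u) (hv : Continuous v) (hΨ : Continuous Ψ) (hΨ0 : ∀ a, 0 ≤ Ψ a)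
    (hΨz : Ψ 0 = 0) {M ρ m : ℝ} (hm : 0 < m) (huM : ∀ x, |u x| ≤ M) (hvM : ∀ x, |v x| ≤ M)
    (hΨρ : ∀ a, Ψ a ≤ 2 * M → ‖a‖ < ρ)
    (huρ : ∀ x y, ‖x - y‖ < ρ → |u x - u y| < m) (hvρ : ∀ x y, ‖x - y‖ < ρ → |v x - v y| < m)
    (hbc : ∀ x ∉ O, u x ≤ v x) {x₀ : Euc d} (hx₀ : x₀ ∈ O) (hmx : m ≤ u x₀ - v x₀) :
    ∃ x ∈ O, ∃ y ∈ O, (∀ x' y', u x' - v y' - Ψ (x' - y') ≤ u x - v y - Ψ (x - y)) ∧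
      m ≤ u x - v y - Ψ (x - y) := by
  have hin : ∀ x y, m ≤ u x - v y - Ψ (x - y) → x ∈ O ∧ y ∈ O := by
    intro x y hxy
    have hclose : ‖x - y‖ < ρ := hΨρ _ (by
      linarith [(abs_le.1 (huM x)).2, (abs_le.1 (hvM y)).1])
    have h0 := hΨ0 (x - y)
    constructor
    · by_contra hx
      linarith [hbc x hx, (abs_lt.1 (hvρ x y hclose)).2]
    · by_contra hy
      linarith [hbc y hy, (abs_lt.1 (huρ x y hclose)).2]
  have hc : IsCompact (closure O ×ˢ closure O) :=
    hO.isCompact_closure.prod hO.isCompact_closure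
  obtain ⟨⟨x, y⟩, -, hxy⟩ := hc.exists_isMaxOn (f := fun q => u q.1 - v q.2 - Ψ (q.1 - q.2))
    ⟨(x₀, x₀), subset_closure hx₀, subset_closure hx₀⟩
    (((hu.comp continuous_fst).sub (hv.comp continuous_snd)).sub
      (hΨ.comp (continuous_fst.sub continuous_snd))).continuousOn
  have hle : ∀ x' ∈ O, ∀ y' ∈ O, u x' - v y' - Ψ (x' - y') ≤ u x - v y - Ψ (x - y) :=
    fun x' hx' y' hy' => hxy (⟨subset_closure hx', subset_closure hy'⟩ :
      (x', y') ∈ closure O ×ˢ closure O)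
  have hmm : m ≤ u x - v y - Ψ (x - y) := by
    have := hle x₀ hx₀ x₀ hx₀
    rw [sub_self, hΨz] at this
    linarith
  refine ⟨x, (hin x y hmm).1, y, (hin x y hmm).2, fun x' y' => ?_, hmm⟩
  by_contra! h
  have := hin x' y' (hmm.trans h.le)
  exact absurd (hle x' this.1 y' this.2) (not_le.2 h)

lemma IsBUC.neg {u : Euc d → ℝ} (hu : IsBUC u) : IsBUC fun x => -u x := by
  obtain ⟨⟨M, hM⟩, h⟩ := hu
  exact ⟨⟨M, fun x => by rw [abs_neg]; exact hM x⟩, h.neg⟩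

lemma exists_test_pair {u v : Euc d → ℝ} (hu : IsBUC u) (hv : IsBUC v) {p κ ε δ η : ℝ}
    (hp1 : 1 ≤ p) (hp2 : p ≤ 2) (hκ : 0 < κ) (hε : 0 < ε) (hδ : 0 < δ) (hδ1 : δ ≤ 1)
    (hη : 0 < η) {x y : Euc d}
    (hmax : ∀ x' y', u x' - v y' - psiK p κ (x' - y') / ε ≤ u x - v y - psiK p κ (x - y) / ε) :
    ∃ (Q : Euc d →L[ℝ] ℝ) (φ φ' : Euc d → ℝ),
      (∀ z w, (u (x + z) - u x - Q z) - (v (y + w) - v y - Q w) ≤ 6 / ε * ‖z - w‖ ^ p) ∧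
      (ContDiff ℝ 2 φ ∧ (∃ M, ∀ y, |φ y| ≤ M) ∧ (∀ y, u y ≤ φ y) ∧ φ x = u x ∧
        fderiv ℝ φ x = Q ∧
        (∀ z, φ (x + z) - φ x - Q z ≤ 6 / ε * ‖z‖ ^ p + η * min 1 (‖z‖ ^ p)) ∧
        ∀ z, δ ≤ ‖z‖ → φ (x + z) ≤ u (x + z) + η * min 1 (‖z‖ ^ p)) ∧
      (ContDiff ℝ 2 φ' ∧ (∃ M, ∀ y, |φ' y| ≤ M) ∧ (∀ y, φ' y ≤ v y) ∧ φ' y = v y ∧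
        fderiv ℝ φ' y = Q ∧
        (∀ z, -(6 / ε * ‖z‖ ^ p + η * min 1 (‖z‖ ^ p)) ≤ φ' (y + z) - φ' y - Q z) ∧
        ∀ z, δ ≤ ‖z‖ → v (y + z) - η * min 1 (‖z‖ ^ p) ≤ φ' (y + z)) := by
  set Q : Euc d →L[ℝ] ℝ := ε⁻¹ • psiKGrad p κ (x - y) with hQ
  have hstep : ∀ h : Euc d,
      psiK p κ (x - y + h) / ε - psiK p κ (x - y) / ε - Q h ≤ 6 / ε * ‖h‖ ^ p := by
    intro h
    have := div_le_div_of_nonneg_right (psiK_add_sub_le hp1 hp2 hκ (x - y) h) hε.le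
    calc _ = (psiK p κ (x - y + h) - psiK p κ (x - y) - psiKGrad p κ (x - y) h) / ε := by
          rw [hQ, smul_apply, smul_eq_mul]; ring
      _ ≤ _ := this
      _ = _ := by ring
  have hΨ : ContDiff ℝ 2 fun a : Euc d => psiK p κ a / ε := (contDiff_psiK hκ).div_const ε
  have hder : HasFDerivAt (fun a : Euc d => psiK p κ a / ε) Q (x - y) := by
    simpa only [div_eq_inv_mul] using (hasFDerivAt_psiK (p := p) hκ (x - y)).const_mul ε⁻¹
  have hder₁ : HasFDerivAt
      (fun a => u x + (psiK p κ (a - y) / ε - psiK p κ (x - y) / ε)) Q x :=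
    ((hder.comp x ((hasFDerivAt_id x).sub_const y)).sub_const _).const_add _
  have hder₂ : HasFDerivAt
      (fun a => -v y + (psiK p κ (x - a) / ε - psiK p κ (x - y) / ε)) (-Q) y := by
    have h := ((hder.comp y ((hasFDerivAt_id y).const_sub x)).sub_const
      (psiK p κ (x - y) / ε)).const_add (-v y)
    have hneg : Q ∘L (-ContinuousLinearMap.id ℝ (Euc d)) = -Q := by ext; simp
    rwa [hneg] at h
  obtain ⟨φ, h1, h2, h3, h4, h5, h6, h7⟩ := exists_levy_test_function (K := 6 / ε) hu
    (φ₀ := fun a => u x + (psiK p κ (a - y) / ε - psiK p κ (x - y) / ε))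
    (contDiff_const.add ((hΨ.comp (contDiff_id.sub contDiff_const)).sub contDiff_const))
    (fun a => by linarith [hmax a y]) (x := x) (by simp) hp1
    (fun z => by
      rw [hder₁.fderiv]
      have := hstep z
      rw [show x - y + z = x + z - y by abel] at this
      linarith) hδ hδ1 hη
  obtain ⟨φ', g1, g2, g3, g4, g5, g6, g7⟩ := exists_levy_test_function (K := 6 / ε) hv.neg
    (φ₀ := fun a => -v y + (psiK p κ (x - a) / ε - psiK p κ (x - y) / ε))
    (contDiff_const.add ((hΨ.comp (contDiff_const.sub contDiff_id)).sub contDiff_const))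
    (fun a => by linarith [hmax x a]) (x := y) (by simp) hp1
    (fun z => by
      rw [hder₂.fderiv, neg_apply]
      have := hstep (-z)
      rw [show x - y + -z = x - (y + z) by abel, map_neg, norm_neg] at this
      linarith) hδ hδ1 hη
  rw [hder₁.fderiv] at h5 h6
  rw [hder₂.fderiv] at g5 g6
  refine ⟨Q, φ, fun a => -φ' a, fun z w => ?_, ⟨h1, h2, h3, h4, h5, h6, h7⟩,
    g1.neg, ?_, fun a => by linarith [g3 a], (congrArg Neg.neg g4).trans (neg_neg _),
    ?_, fun z => ?_, fun z hz => ?_⟩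
  · have e1 := hmax (x + z) (y + w)
    have e2 := hstep (z - w)
    rw [show x - y + (z - w) = x + z - (y + w) by abel, map_sub] at e2
    linarith
  · obtain ⟨M, hM⟩ := g2
    exact ⟨M, fun a => by rw [abs_neg]; exact hM a⟩
  · rw [fderiv_fun_neg, g5, neg_neg]
  · have := g6 z
    rw [neg_apply] at this
    linarith
  · linarith [g7 z hz]

lemma IsModulus.exists_pos_lt {θ : ℝ → ℝ} (hθ : IsModulus θ) {e : ℝ} (he : 0 < e) :
    ∃ ρ > 0, ∀ t ≤ ρ, θ t < e := by
  obtain ⟨ρ, h1, h2⟩ := ((hθ.2.2.eventually_lt_const he).and self_mem_nhdsWithin).exists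
  exact ⟨ρ, h2, fun t ht => (hθ.2.1 ht).trans_lt h1⟩

lemma IsBUC.exists_abs_sub_lt {u : Euc d → ℝ} (hu : IsBUC u) {e : ℝ} (he : 0 < e) :
    ∃ ρ > 0, ∀ x y, ‖x - y‖ < ρ → |u x - u y| < e := by
  obtain ⟨ρ, h1, h2⟩ := Metric.uniformContinuous_iff.1 hu.2 e he
  exact ⟨ρ, h1, fun x y h => by
    simpa only [Real.dist_eq] using @h2 x y (by rwa [dist_eq_norm])⟩

/-- Theorem 6.2: comparison under Assumption A1 (Hölder continuity of the measures in the
transport metric) and Assumptions B–E, when one of the two functions is `r`-Hölder on `𝒪`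
with `1 - r/p < s`. -/
theorem comparison_with_holder_regularity
    {d : ℕ} {A B : Type*} [Nonempty A] [Nonempty B]
    (O : Set (Euc d)) (hOopen : IsOpen O) (hObdd : Bornology.IsBounded O)
    (hOconn : IsConnected O)
    (p : ℝ) (hp1 : 1 ≤ p) (hp2 : p ≤ 2)
    (s : ℝ) (hs0 : 0 < s) (hs1 : s < 1)
    (r : ℝ) (hr0 : 0 < r) (hr1 : r < 1)
    (hrs : 1 - r / p < s)
    (μf : Euc d → A → B → Measure (Euc d)) (c f : A → B → Euc d → ℝ)
    (hLevy : ∀ x ∈ O, ∀ (α : A) (β : B), IsLevyLp p (μf x α β))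
    (hA1 : AssumptionA1 O p s (fun x α β => (μf x α β).restrict (ball (0 : Euc d) 1)))
    (hB : AssumptionB O (fun x α β => (μf x α β).restrict (ball (0 : Euc d) 1)ᶜ))
    (hC : AssumptionC O f) (hD : AssumptionD O c) (hE : AssumptionE O p μf)
    (u v : Euc d → ℝ) (hu : IsBUC u) (hv : IsBUC v)
    (hsub : IsSubsolution O (Iop μf c f) u)
    (hsup : IsSupersolution O (Iop μf c f) v)
    (hbc : ∀ x ∉ O, u x ≤ v x)
    (hHolder : (∃ Ch : ℝ, ∀ x ∈ O, ∀ y ∈ O, |u x - u y| ≤ Ch * ‖x - y‖ ^ r) ∨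
               (∃ Ch : ℝ, ∀ x ∈ O, ∀ y ∈ O, |v x - v y| ≤ Ch * ‖x - y‖ ^ r)) :
    ∀ x ∈ O, u x ≤ v x := by
  obtain ⟨C, hC0, hA1⟩ := hA1
  obtain ⟨θB, hθB, hB⟩ := hB
  obtain ⟨θC, hθC, Cf, hCf, hC, hfb⟩ := hC
  obtain ⟨lam, lam1, hlam, hlam1, hcb, θD, hθD, hD⟩ := hD
  obtain ⟨⟨θE, hθE, hE⟩, Λ, hΛ, hμΛ⟩ := hE
  obtain ⟨Mu, hMu⟩ := hu.1
  obtain ⟨Mv, hMv⟩ := hv.1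
  obtain ⟨M, hM, huM, hvM⟩ : ∃ M > 0, (∀ x, |u x| ≤ M) ∧ ∀ x, |v x| ≤ M :=
    ⟨|Mu| + |Mv| + 1, by positivity,
      fun x => (hMu x).trans (by linarith [le_abs_self Mu, abs_nonneg Mv]),
      fun x => (hMv x).trans (by linarith [le_abs_self Mv, abs_nonneg Mu])⟩
  obtain ⟨Ch, hCh, hHolder⟩ : ∃ Ch > 0,
      (∀ x ∈ O, ∀ y ∈ O, |u x - u y| ≤ Ch * ‖x - y‖ ^ r) ∨
      (∀ x ∈ O, ∀ y ∈ O, |v x - v y| ≤ Ch * ‖x - y‖ ^ r) := by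
    rcases hHolder with ⟨Ch, h⟩ | ⟨Ch, h⟩
    · exact ⟨max Ch 1, by positivity, Or.inl fun x hx y hy => (h x hx y hy).trans
        (mul_le_mul_of_nonneg_right (le_max_left _ _) (by positivity))⟩
    · exact ⟨max Ch 1, by positivity, Or.inr fun x hx y hy => (h x hx y hy).trans
        (mul_le_mul_of_nonneg_right (le_max_left _ _) (by positivity))⟩
  intro x₀ hx₀
  by_contra! hlt
  obtain ⟨m, hm, hmx⟩ : ∃ m > 0, m ≤ u x₀ - v x₀ := ⟨_, sub_pos.2 hlt, le_rfl⟩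
  obtain ⟨e, he, hem⟩ : ∃ e > 0, 8 * e = lam * m := ⟨lam * m / 8, by positivity, by ring⟩
  obtain ⟨ρ₁, hρ₁, hρu⟩ := hu.exists_abs_sub_lt hm
  obtain ⟨ρ₂, hρ₂, hρv⟩ := hv.exists_abs_sub_lt hm
  obtain ⟨ρ₃, hρ₃, hρB⟩ := hθB.exists_pos_lt (div_pos he (mul_pos two_pos hM))
  obtain ⟨ρ₄, hρ₄, hρC⟩ := hθC.exists_pos_lt he
  obtain ⟨ρ₅, hρ₅, hρD⟩ := hθD.exists_pos_lt (div_pos he hM)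
  obtain ⟨η₁, hη₁, h1, h2, h3, h4, h5, hη₁e⟩ : ∃ η₁ > 0, η₁ ≤ ρ₁ ∧ η₁ ≤ ρ₂ ∧ η₁ ≤ ρ₃ ∧
      η₁ ≤ ρ₄ ∧ η₁ ≤ ρ₅ ∧ 24 * C ^ p * η₁ ≤ e := by
    have hCp : 0 < 24 * C ^ p := by positivity
    have hq : 0 < e / (24 * C ^ p) := by positivity
    refine ⟨min ρ₁ (min ρ₂ (min ρ₃ (min ρ₄ (min ρ₅ (e / (24 * C ^ p)))))), by positivity,
      by simp, by simp, by simp, by simp, by simp, ?_⟩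
    rw [mul_comm, ← le_div_iff₀ hCp]
    simp
  obtain ⟨ε, κ, hε, hκ, hclose, hsmall⟩ :=
    exists_penalization_params (M := 2 * M) hp1 hs0 hs1 hr1 hrs hCh hη₁
  have hp0 : 0 < p := by linarith
  obtain ⟨x, hx, y, hy, hmax, hmxy⟩ := exists_doubling_max (Ψ := fun a => psiK p κ a / ε) hObdd
    hu.2.continuous hv.2.continuous ((contDiff_psiK hκ).continuous.div_const ε)
    (fun a => div_nonneg (psiK_nonneg hp0.le hκ a) hε.le) (by simp [psiK_zero]) hm huM hvM
    (fun a ha => hclose ‖a‖ (norm_nonneg a) ha)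
    (fun x y h => hρu x y (h.trans_le h1)) (fun x y h => hρv x y (h.trans_le h2)) hbc hx₀ hmx
  have hΨ0 : 0 ≤ psiK p κ (x - y) / ε := div_nonneg (psiK_nonneg hp0.le hκ _) hε.le
  have hxy : ‖x - y‖ ≤ η₁ := (hclose _ (norm_nonneg _) (by
    change psiK p κ (x - y) / ε ≤ _
    linarith [(abs_le.1 (huM x)).2, (abs_le.1 (hvM y)).1])).le
  have hts : (‖x - y‖ ^ s) ^ p ≤ η₁ * ε := by
    refine hsmall _ (norm_nonneg _) ?_
    change psiK p κ (x - y) / ε ≤ _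
    rcases hHolder with h | h
    · have e1 := hmax y y
      rw [sub_self, psiK_zero, zero_div] at e1
      linarith [(abs_le.1 (h x hx y hy)).2]
    · have e1 := hmax x x
      rw [sub_self, psiK_zero, zero_div] at e1
      linarith [(abs_le.1 (h x hx y hy)).2]
  have hdist : ∀ α β, (dLpPow p ((μf x α β).restrict (ball 0 1))
      ((μf y α β).restrict (ball 0 1))).toReal ≤ C ^ p * (η₁ * ε) := by
    intro α β
    have h := Real.rpow_le_rpow (Real.rpow_nonneg ENNReal.toReal_nonneg _) (hA1 x hx y hy α β)
      hp0.le
    rw [← Real.rpow_mul ENNReal.toReal_nonneg, one_div_mul_cancel hp0.ne', Real.rpow_one,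
      Real.mul_rpow hC0.le (by positivity)] at h
    exact h.trans (mul_le_mul_of_nonneg_left hts (by positivity))
  have hK : 0 < 6 / ε := by positivity
  obtain ⟨δ₀, hδ₀, hδE⟩ := hθE.exists_pos_lt (div_pos he (mul_pos two_pos hK))
  obtain ⟨δ, hδ, hδ1, hδδ⟩ : ∃ δ > 0, δ ≤ 1 ∧ 2 * δ ≤ δ₀ :=
    ⟨min 1 (δ₀ / 2), by positivity, min_le_left _ _, by linarith [min_le_right 1 (δ₀ / 2)]⟩
  obtain ⟨η, hη, hηe⟩ : ∃ η > 0, 4 * (η * Λ) ≤ e := by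
    refine ⟨e / (4 * (Λ + 1)), by positivity, ?_⟩
    have : 4 * (e / (4 * (Λ + 1)) * Λ) = e * (Λ / (Λ + 1)) := by field_simp
    rw [this]
    exact mul_le_of_le_one_right he.le ((div_le_one (by positivity)).2 (by linarith))
  obtain ⟨Q, φ, φ', hQ, ⟨a1, a2, a3, a4, a5, a6, a7⟩, b1, b2, b3, b4, b5, b6, b7⟩ :=
    exists_test_pair hu hv hp1 hp2 hκ hε hδ hδ1 hη hmax
  have hFle := hsub φ a1 a2 x hx (fun z => by linarith [a3 z]) a4
  have hGge := hsup φ' b1 b2 y hy (fun z => by linarith [b3 z]) b4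
  obtain ⟨R₁, hR₁⟩ := exists_abs_Lop_le hΛ hp1 hp2 a1 a2 x
  obtain ⟨R₂, hR₂⟩ := exists_abs_Lop_le hΛ hp1 hp2 b1 b2 y
  have hbound : ∀ {L a w g R : ℝ}, |L| ≤ R → lam ≤ a → a ≤ lam1 → |w| ≤ M → |g| ≤ Cf →
      |-L + a * w + g| ≤ R + lam1 * M + Cf := by
    intro L a w g R hL ha ha1 hw hg
    have haw : |a * w| ≤ lam1 * M := by
      rw [abs_mul, abs_of_pos (hlam.trans_le ha)]
      exact mul_le_mul ha1 hw (abs_nonneg _) (hlam.le.trans hlam1)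
    refine (abs_add_le _ _).trans (add_le_add ((abs_add_le _ _).trans (add_le_add ?_ haw)) hg)
    rwa [abs_neg]
  have hk := nonpos_of_iSup_iInf_gap (k := 2 * e)
    (R := max R₁ R₂ + lam1 * M + Cf)
    (fun α β => hbound ((hR₁ _ (hLevy x hx α β) (hμΛ x hx α β)).trans (le_max_left _ _))
      (hcb x hx α β).1 (hcb x hx α β).2 (a4 ▸ huM x) (hfb x hx α β))
    (fun α β => hbound ((hR₂ _ (hLevy y hy α β) (hμΛ y hy α β)).trans (le_max_right _ _))
      (hcb y hy α β).1 (hcb y hy α β).2 (b4 ▸ hvM y) (hfb y hy α β))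
    (fun α β => ?_) hFle hGge
  · linarith
  have hL := Lop_sub_Lop_le hp1 hp2 hK.le hδ1 hη.le (hθE.1 (2 * δ)) hΛ (hθB.1 ‖x - y‖)
    (hLevy x hx α β) (hLevy y hy α β) (hE _ (by positivity) x hx α β)
    (hE _ (by positivity) y hy α β) (hμΛ x hx α β) (hμΛ y hy α β) (hB x hx y hy α β)
    hv.2.continuous hvM hQ a1 a2 a4 a5 b1 b2 b4 b5 a6 a7 b6 b7
  have r1 : 4 * (6 / ε) * (dLpPow p ((μf x α β).restrict (ball 0 1))
      ((μf y α β).restrict (ball 0 1))).toReal ≤ e := by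
    refine (mul_le_mul_of_nonneg_left (hdist α β) (by positivity)).trans ?_
    calc _ = 24 * C ^ p * η₁ := by field_simp; ring
      _ ≤ e := hη₁e
  have r2 : 2 * (6 / ε * θE (2 * δ)) ≤ e := by
    have := (lt_div_iff₀ (mul_pos two_pos hK)).1 (hδE _ hδδ)
    linarith
  have r3 : 2 * M * θB ‖x - y‖ ≤ e := by
    have := (lt_div_iff₀ (mul_pos two_pos hM)).1 (hρB _ (hxy.trans h3))
    linarith
  have r4 : |(c α β x - c α β y) * v y| ≤ e := by
    rw [abs_mul]
    calc _ ≤ e / M * M := mul_le_mul ((hD x hx y hy α β).trans (hρD _ (hxy.trans h5)).le) (hvM y)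
          (abs_nonneg _) (by positivity)
      _ = e := div_mul_cancel₀ _ hM.ne'
  have r5 := (hC x hx y hy α β).trans (hρC _ (hxy.trans h4)).le
  have r6 : lam * m ≤ c α β x * (u x - v y) :=
    mul_le_mul (hcb x hx α β).1 (by linarith) hm.le (hlam.le.trans (hcb x hx α β).1)
  rw [a4, b4]
  linarith [(abs_le.1 r4).1, (abs_le.1 r5).1]
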